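/- arXiv:2507.07510 — 5 statements merged into one kernel-verified Lean document; each statement's English description precedes it below -/
import Mathlib

section
/- For every real u, the second derivative of f satisfies f''(u) = (exp(u) / (1 + exp(u))^3) · g(u); in particular, for every u, f''(u) and g(u) have the same sign (f''(u) > 0 iff g(u) > 0, f''(u) = 0 iff g(u) = 0, and f''(u) < 0 iff g(u) < 0). -/
/-- The logistic sigmoid σ(u) = 1/(1+exp(−u)). -/
noncomputable def sigmoid (u : ℝ) : ℝ := 1 / (1 + Real.exp (-u))

/-- L := log((1−α)/α). -/
noncomputable def L (α : ℝ) : ℝ := Real.log ((1 - α) / α)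

/-- f(u) := σ(u)·log(σ(u)/(1−α)) + σ(−u)·log(σ(−u)/α). -/
noncomputable def f (α : ℝ) (u : ℝ) : ℝ :=
  sigmoid u * Real.log (sigmoid u / (1 - α)) + sigmoid (-u) * Real.log (sigmoid (-u) / α)

/-- g(u) := −u·exp(u) + (L+1)·exp(u) + u + 1 − L. -/
noncomputable def g (α : ℝ) (u : ℝ) : ℝ :=
  -u * Real.exp u + (L α + 1) * Real.exp u + u + 1 - L α

theorem sigmoid_eq (u : ℝ) : sigmoid u = Real.exp u / (1 + Real.exp u) := by
  have h := Real.exp_pos u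
  rw [sigmoid, Real.exp_neg]
  field_simp
  ring

theorem sigmoid_neg_eq (u : ℝ) : sigmoid (-u) = 1 / (1 + Real.exp u) := by
  rw [sigmoid, neg_neg]

theorem f_eq {α : ℝ} (hα : α ∈ Set.Ioo (0 : ℝ) 1) (u : ℝ) :
    f α u = Real.exp u / (1 + Real.exp u) * (u - L α) - Real.log (1 + Real.exp u)
      - Real.log α := by
  have h0 : α ≠ 0 := hα.1.ne'
  have h1 : 1 - α ≠ 0 := (sub_pos.2 hα.2).ne'
  have he := Real.exp_pos u
  have hs : 1 + Real.exp u ≠ 0 := by positivity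
  rw [f, L, sigmoid_eq, sigmoid_neg_eq, Real.log_div (by positivity) h1,
    Real.log_div he.ne' hs, Real.log_exp, Real.log_div (by positivity) h0,
    Real.log_div one_ne_zero hs, Real.log_one, Real.log_div h1 h0]
  field_simp
  ring

theorem hasDerivAt_one_add_exp (u : ℝ) :
    HasDerivAt (fun x => 1 + Real.exp x) (Real.exp u) u :=
  (Real.hasDerivAt_exp u).const_add 1

theorem hasDerivAt_f {α : ℝ} (hα : α ∈ Set.Ioo (0 : ℝ) 1) (u : ℝ) :
    HasDerivAt (f α) (Real.exp u / (1 + Real.exp u) ^ 2 * (u - L α)) u := by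
  have hs : 1 + Real.exp u ≠ 0 := by positivity
  have hσ := (Real.hasDerivAt_exp u).fun_div (hasDerivAt_one_add_exp u) hs
  have h := ((hσ.fun_mul ((hasDerivAt_id' u).sub_const (L α))).fun_sub
    ((hasDerivAt_one_add_exp u).log hs)).sub_const (Real.log α)
  rw [funext (f_eq hα)]
  refine h.congr_deriv ?_
  field_simp
  ring

theorem hasDerivAt_deriv_f {α : ℝ} (hα : α ∈ Set.Ioo (0 : ℝ) 1) (u : ℝ) :
    HasDerivAt (deriv (f α)) (Real.exp u / (1 + Real.exp u) ^ 3 * g α u) u := by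
  have hs : 1 + Real.exp u ≠ 0 := by positivity
  have h := ((Real.hasDerivAt_exp u).fun_div ((hasDerivAt_one_add_exp u).fun_pow 2)
    (pow_ne_zero 2 hs)).fun_mul ((hasDerivAt_id' u).sub_const (L α))
  rw [funext fun x => (hasDerivAt_f hα x).deriv]
  refine h.congr_deriv ?_
  rw [g]
  field_simp
  push_cast
  ring

theorem stmt_0 (α : ℝ) (hα : α ∈ Set.Ioo (0 : ℝ) 1) (u : ℝ) :
    deriv (deriv (f α)) u = Real.exp u / (1 + Real.exp u) ^ 3 * g α u ∧
    (0 < deriv (deriv (f α)) u ↔ 0 < g α u) ∧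
    (deriv (deriv (f α)) u = 0 ↔ g α u = 0) ∧
    (deriv (deriv (f α)) u < 0 ↔ g α u < 0) := by
  have hpos : 0 < Real.exp u / (1 + Real.exp u) ^ 3 := by positivity
  rw [(hasDerivAt_deriv_f hα u).deriv]
  exact ⟨rfl, mul_pos_iff_of_pos_left hpos, mul_eq_zero_iff_left hpos.ne',
    ⟨fun h => (pos_iff_neg_of_mul_neg h).1 hpos, mul_neg_of_pos_of_neg hpos⟩⟩
end

section
/- The function f attains its unique global minimum at u = L: f(L) = 0, and f(u) > 0 for every real u ≠ L. Consequently f is strictly decreasing on (−∞, L] and strictly increasing on [L, ∞). -/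
theorem f_L {α : ℝ} (hα : α ∈ Set.Ioo (0 : ℝ) 1) : f α (L α) = 0 := by
  have hα₁ : 0 < 1 - α := sub_pos.2 hα.2
  have hα₀ : α ≠ 0 := hα.1.ne'
  have h : 1 + Real.exp (L α) = α⁻¹ := by
    rw [L, Real.exp_log (div_pos hα₁ hα.1)]
    field_simp
    ring
  rw [f_eq hα, h, Real.log_inv]
  ring

theorem strictAntiOn_f {α : ℝ} (hα : α ∈ Set.Ioo (0 : ℝ) 1) :
    StrictAntiOn (f α) (Set.Iic (L α)) := by
  refine strictAntiOn_of_deriv_neg (convex_Iic _)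
    (fun u _ => (hasDerivAt_f hα u).continuousAt.continuousWithinAt) fun u hu => ?_
  rw [interior_Iic] at hu
  rw [(hasDerivAt_f hα u).deriv]
  exact mul_neg_of_pos_of_neg (by positivity) (sub_neg.2 hu)

theorem strictMonoOn_f {α : ℝ} (hα : α ∈ Set.Ioo (0 : ℝ) 1) :
    StrictMonoOn (f α) (Set.Ici (L α)) := by
  refine strictMonoOn_of_deriv_pos (convex_Ici _)
    (fun u _ => (hasDerivAt_f hα u).continuousAt.continuousWithinAt) fun u hu => ?_
  rw [interior_Ici] at hu
  rw [(hasDerivAt_f hα u).deriv]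
  exact mul_pos (by positivity) (sub_pos.2 hu)

theorem stmt_2 (α : ℝ) (hα : α ∈ Set.Ioo (0 : ℝ) 1) :
    f α (L α) = 0 ∧ (∀ u : ℝ, u ≠ L α → 0 < f α u) ∧
    StrictAntiOn (f α) (Set.Iic (L α)) ∧ StrictMonoOn (f α) (Set.Ici (L α)) := by
  refine ⟨f_L hα, fun u hu => ?_, strictAntiOn_f hα, strictMonoOn_f hα⟩
  rw [← f_L hα]
  rcases hu.lt_or_gt with h | h
  · exact strictAntiOn_f hα h.le Set.self_mem_Iic h
  · exact strictMonoOn_f hα Set.self_mem_Ici h.le h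
end

section
/- There exists a unique real number u₁ such that g'(u₁) = 0; moreover u₁ > L − 1, g'(u) > 0 for every u < u₁, and g'(u) < 0 for every u > u₁. Consequently g is strictly increasing on (−∞, u₁] and strictly decreasing on [u₁, ∞). -/
theorem hasDerivAt_g (α u : ℝ) :
    HasDerivAt (g α) (Real.exp u * (L α - u + Real.exp (-u))) u := by
  have h : HasDerivAt (g α) _ u :=
    (((((hasDerivAt_id u).neg.mul (Real.hasDerivAt_exp u)).add
      ((Real.hasDerivAt_exp u).const_mul (L α + 1))).add (hasDerivAt_id u)).add_const 1).sub_const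
      (L α)
  refine h.congr_deriv ?_
  have he : Real.exp u * Real.exp (-u) = 1 := by rw [← Real.exp_add]; simp
  simp only [Pi.neg_apply, id]
  linear_combination -he

theorem strictAnti_sub_add_exp_neg (c : ℝ) : StrictAnti fun u : ℝ => c - u + Real.exp (-u) := by
  intro a b hab
  have := Real.exp_lt_exp.2 (neg_lt_neg hab)
  dsimp only
  linarith

theorem exists_sub_add_exp_neg_eq_zero (c : ℝ) : ∃ u, c ≤ u ∧ c - u + Real.exp (-u) = 0 := by
  have hle : c ≤ c + Real.exp (-c) := by linarith [Real.exp_pos (-c)]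
  have hcont : ContinuousOn (fun u : ℝ => c - u + Real.exp (-u)) (Set.Icc c (c + Real.exp (-c))) := by
    fun_prop
  obtain ⟨u, hu, h⟩ := intermediate_value_Icc' hle hcont (show (0 : ℝ) ∈ Set.Icc _ _ by
    have := Real.exp_le_exp.2 (neg_le_neg hle)
    constructor <;> linarith [Real.exp_pos (-c)])
  exact ⟨u, hu.1, h⟩

theorem stmt_5 (α : ℝ) (hα : α ∈ Set.Ioo (0 : ℝ) 1) :
    ∃ u₁ : ℝ, deriv (g α) u₁ = 0 ∧ (∀ u : ℝ, deriv (g α) u = 0 → u = u₁) ∧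
      L α - 1 < u₁ ∧
      (∀ u : ℝ, u < u₁ → 0 < deriv (g α) u) ∧
      (∀ u : ℝ, u₁ < u → deriv (g α) u < 0) ∧
      StrictMonoOn (g α) (Set.Iic u₁) ∧ StrictAntiOn (g α) (Set.Ici u₁) := by
  obtain ⟨u₁, hL, h0⟩ := exists_sub_add_exp_neg_eq_zero (L α)
  have hd (u : ℝ) : deriv (g α) u = Real.exp u * (L α - u + Real.exp (-u)) :=
    (hasDerivAt_g α u).deriv
  have hanti := strictAnti_sub_add_exp_neg (L α)
  have hpos : ∀ u : ℝ, u < u₁ → 0 < deriv (g α) u := fun u hu => by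
    rw [hd]
    exact mul_pos (Real.exp_pos u) (h0.symm.trans_lt (hanti hu))
  have hneg : ∀ u : ℝ, u₁ < u → deriv (g α) u < 0 := fun u hu => by
    rw [hd]
    exact mul_neg_of_pos_of_neg (Real.exp_pos u) ((hanti hu).trans_eq h0)
  have hcont : Continuous (g α) :=
    continuous_iff_continuousAt.2 fun u => (hasDerivAt_g α u).continuousAt
  refine ⟨u₁, by rw [hd, h0, mul_zero], fun u hu => ?_, by linarith, hpos, hneg, ?_, ?_⟩
  · rcases lt_trichotomy u u₁ with h | h | h
    · exact absurd hu (hpos u h).ne'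
    · exact h
    · exact absurd hu (hneg u h).ne
  · refine strictMonoOn_of_deriv_pos (convex_Iic u₁) hcont.continuousOn fun u hu => hpos u ?_
    simpa using hu
  · refine strictAntiOn_of_deriv_neg (convex_Ici u₁) hcont.continuousOn fun u hu => hneg u ?_
    simpa using hu
end

section
/- For every α ∈ (0,1), there exist real numbers h₁ and h₂ with h₁ < 0 < h₂ such that the set { u : ℝ | g(u) > 0 } equals the open interval (h₁, h₂); moreover L lies in (h₁, h₂), i.e., h₁ < L < h₂. -/
theorem g_eq (α u : ℝ) :
    g α u = Real.exp u + 1 - (u - L α) * (Real.exp u - 1) := by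
  unfold g; ring

theorem g_pos_of_lt_of_pos {α u v : ℝ} (hu : 0 < u) (huv : u < v) (hv : 0 < g α v) :
    0 < g α u := by
  rw [g_eq] at *
  have hA : 1 < Real.exp u := Real.one_lt_exp_iff.2 hu
  have hB : Real.exp u < Real.exp v := Real.exp_lt_exp.2 huv
  generalize Real.exp u = A at *
  generalize Real.exp v = B at *
  have h₁ : v - L α < (B + 1) / (B - 1) := by
    rw [lt_div_iff₀ (by linarith)]; linarith
  have h₂ : (B + 1) / (B - 1) ≤ (A + 1) / (A - 1) := by
    rw [div_le_div_iff₀ (by linarith) (by linarith)]; nlinarith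
  have h₃ : u - L α < (A + 1) / (A - 1) := by linarith
  rw [lt_div_iff₀ (by linarith)] at h₃
  linarith

theorem g_pos_of_lt_of_neg {α u v : ℝ} (hu : u < 0) (hvu : v < u) (hv : 0 < g α v) :
    0 < g α u := by
  rw [g_eq] at *
  have hA : Real.exp u < 1 := Real.exp_lt_one_iff.2 hu
  have hB : Real.exp v < Real.exp u := Real.exp_lt_exp.2 hvu
  generalize Real.exp u = A at *
  generalize Real.exp v = B at *
  have h₁ : L α - v < (1 + B) / (1 - B) := by
    rw [lt_div_iff₀ (by linarith)]; linarith
  have h₂ : (1 + B) / (1 - B) ≤ (1 + A) / (1 - A) := by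
    rw [div_le_div_iff₀ (by linarith) (by linarith)]; nlinarith
  have h₃ : L α - u < (1 + A) / (1 - A) := by linarith
  rw [lt_div_iff₀ (by linarith)] at h₃
  linarith

theorem g_zero_pos (α : ℝ) : 0 < g α 0 := by
  simp [g_eq]

theorem g_L_pos (α : ℝ) : 0 < g α (L α) := by
  rw [g_eq, sub_self, zero_mul, sub_zero]; positivity

theorem ordConnected_g_pos (α : ℝ) : {u : ℝ | 0 < g α u}.OrdConnected := by
  refine ⟨fun a ha b hb u hu => ?_⟩
  rcases lt_trichotomy u 0 with h | rfl | h
  · rcases hu.1.eq_or_lt with rfl | h'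
    · exact ha
    · exact g_pos_of_lt_of_neg h h' ha
  · exact g_zero_pos α
  · rcases hu.2.eq_or_lt with rfl | h'
    · exact hb
    · exact g_pos_of_lt_of_pos h h' hb

theorem isOpen_g_pos (α : ℝ) : IsOpen {u : ℝ | 0 < g α u} := by
  refine isOpen_lt continuous_const ?_
  unfold g
  fun_prop

theorem bddAbove_g_pos (α : ℝ) : BddAbove {u : ℝ | 0 < g α u} := by
  refine ⟨2 + |L α|, fun u (hu : 0 < g α u) => ?_⟩
  by_contra! h
  rw [g_eq] at hu
  have hL := le_abs_self (L α)
  have hL' := abs_nonneg (L α)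
  have he := Real.add_one_le_exp u
  nlinarith [mul_nonneg (show 0 ≤ u - L α - 2 by linarith)
    (show 0 ≤ Real.exp u - 1 by linarith)]

theorem bddBelow_g_pos (α : ℝ) : BddBelow {u : ℝ | 0 < g α u} := by
  refine ⟨-(2 + |L α|), fun u (hu : 0 < g α u) => ?_⟩
  by_contra! h
  rw [g_eq] at hu
  have hL := neg_abs_le (L α)
  have hL' := abs_nonneg (L α)
  have he := Real.add_one_le_exp (-u)
  have hm : Real.exp u * Real.exp (-u) = 1 := by rw [← Real.exp_add]; simp
  have hp := Real.exp_pos u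
  have h3 : 3 * Real.exp u ≤ 1 := by nlinarith
  nlinarith [mul_nonneg (show 0 ≤ L α - u - 2 by linarith)
    (show 0 ≤ 1 - Real.exp u by linarith)]

theorem stmt_11 (α : ℝ) (hα : α ∈ Set.Ioo (0 : ℝ) 1) :
    ∃ h₁ h₂ : ℝ, h₁ < 0 ∧ 0 < h₂ ∧
      {u : ℝ | 0 < g α u} = Set.Ioo h₁ h₂ ∧
      h₁ < L α ∧ L α < h₂ := by
  have hS : {u : ℝ | 0 < g α u} =
      Set.Ioo (sInf {u : ℝ | 0 < g α u}) (sSup {u : ℝ | 0 < g α u}) := by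
    apply Set.Subset.antisymm
    · rw [← interior_Icc]
      exact interior_maximal
        (subset_Icc_csInf_csSup (bddBelow_g_pos α) (bddAbove_g_pos α)) (isOpen_g_pos α)
    · exact IsConnected.Ioo_csInf_csSup_subset
        ⟨⟨0, g_zero_pos α⟩, (ordConnected_g_pos α).isPreconnected⟩
        (bddBelow_g_pos α) (bddAbove_g_pos α)
  have h0 := hS.subset (g_zero_pos α)
  have hL := hS.subset (g_L_pos α)
  exact ⟨_, _, h0.1, h0.2, hS, hL.1, hL.2⟩
end

section
/- RLHF–KL decomposition (discrete version): let X be a nonempty finite type, p_ref : X → ℝ a probability mass function with p_ref(x) > 0 for all x, p : X → ℝ a probability mass function with p(x) > 0 for all x, r : X → ℝ a reward function, and β > 0. Define Z := Σ_x p_ref(x)·exp(r(x)/β) and p*(x) := p_ref(x)·exp(r(x)/β)/Z. Then Σ_x p(x)·r(x) − β·Σ_x p(x)·log(p(x)/p_ref(x)) = β·log Z − β·Σ_x p(x)·log(p(x)/p*(x)); i.e., the KL-regularized reward objective equals β·log Z minus β times the reverse KL divergence from p to the Boltzmann-rational distribution p*. -/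
open scoped BigOperators

/-- RLHF–KL decomposition (discrete version). -/
theorem stmt_15 {X : Type*} [Fintype X] [Nonempty X]
    (pref p : X → ℝ) (r : X → ℝ) (β : ℝ) (hβ : 0 < β)
    (hpref_pos : ∀ x, 0 < pref x) (hpref_sum : ∑ x, pref x = 1)
    (hp_pos : ∀ x, 0 < p x) (hp_sum : ∑ x, p x = 1) :
    ∑ x, p x * r x - β * ∑ x, p x * Real.log (p x / pref x) =
      β * Real.log (∑ x, pref x * Real.exp (r x / β)) -
        β * ∑ x, p x *
          Real.log (p x /
            (pref x * Real.exp (r x / β) / (∑ y, pref y * Real.exp (r y / β)))) := by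
  have hZ : 0 < ∑ y, pref y * Real.exp (r y / β) :=
    Finset.sum_pos (fun y _ => mul_pos (hpref_pos y) (Real.exp_pos _)) Finset.univ_nonempty
  set Z := ∑ y, pref y * Real.exp (r y / β)
  have hlog : ∀ x, p x * Real.log (p x / (pref x * Real.exp (r x / β) / Z)) =
      p x * Real.log (p x / pref x) - p x * r x / β + p x * Real.log Z := by
    intro x
    have hp := (hp_pos x).ne'
    have hpref := (hpref_pos x).ne'
    have hexp := (Real.exp_pos (r x / β)).ne'
    rw [Real.log_div hp (div_ne_zero (mul_ne_zero hpref hexp) hZ.ne'),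
      Real.log_div (mul_ne_zero hpref hexp) hZ.ne', Real.log_mul hpref hexp, Real.log_exp,
      Real.log_div hp hpref]
    ring
  simp_rw [hlog]
  rw [Finset.sum_add_distrib, Finset.sum_sub_distrib, ← Finset.sum_mul, hp_sum,
    ← Finset.sum_div]
  field_simp
  ring
end
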